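/- Let φ be a Maharam submeasure on the Borel subsets of Cantor space 2^ℕ. Then there is a Borel set B such that φ has a control measure on B (there is a finite Borel measure μ such that for every Borel set C ⊆ B, μ(C) = 0 if and only if φ(C) = 0), and φ is pathological on the complement of B (there is no nonzero finitely additive functional ν with ν(A) ≤ φ(A ∖ B) for every Borel set A). -/

import Mathlib

open Set Filter NNReal

/-- Cantor space `2^ℕ`. -/
abbrev Cantor := ℕ → Bool

/-- A submeasure on the Borel subsets of Cantor space: vanishes on `∅`, is
monotone and subadditive on Borel sets. -/
def Submeasure (φ : Set Cantor → ℝ≥0) : Prop :=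
  φ ∅ = 0 ∧
  (∀ A B : Set Cantor, MeasurableSet A → MeasurableSet B → A ⊆ B → φ A ≤ φ B) ∧
  (∀ A B : Set Cantor, MeasurableSet A → MeasurableSet B → φ (A ∪ B) ≤ φ A + φ B)

/-- A Maharam (continuous) submeasure: a submeasure which is continuous along
decreasing sequences of Borel sets. -/
def Maharam (φ : Set Cantor → ℝ≥0) : Prop :=
  Submeasure φ ∧
  ∀ A : ℕ → Set Cantor, (∀ n, MeasurableSet (A n)) → Antitone A →
    Tendsto (fun n => φ (A n)) atTop (nhds (φ (⋂ n, A n)))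

/-- `φ` is diffuse: singletons are null. -/
def Diffuse (φ : Set Cantor → ℝ≥0) : Prop :=
  ∀ x : Cantor, φ ({x} : Set Cantor) = 0

/-- `ν` is a finitely additive functional on the Borel sets. -/
def FinAdd (ν : Set Cantor → ℝ≥0) : Prop :=
  ν ∅ = 0 ∧
  ∀ A B : Set Cantor, MeasurableSet A → MeasurableSet B → Disjoint A B →
    ν (A ∪ B) = ν A + ν B

theorem Submeasure.apply_union_null {φ : Set Cantor → ℝ≥0} (hφ : Submeasure φ) {A B : Set Cantor}
    (hA : MeasurableSet A) (hB : MeasurableSet B) (h : φ B = 0) : φ (A ∪ B) ≤ φ A := by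
  simpa [h] using hφ.2.2 A B hA hB

/-- Monotone unions are approximated from below by a Maharam submeasure. -/
theorem Maharam.tendsto_iUnion_diff {φ : Set Cantor → ℝ≥0} (hφ : Maharam φ)
    {B : ℕ → Set Cantor} (hB : ∀ n, MeasurableSet (B n)) (hmono : Monotone B) :
    Tendsto (fun n => φ ((⋃ k, B k) \ B n)) atTop (nhds 0) := by
  have h := hφ.2 (fun n => (⋃ k, B k) \ B n) (fun n => (MeasurableSet.iUnion hB).diff (hB n))
    fun m n hmn => sdiff_subset_sdiff_right (hmono hmn)
  have hempty : ⋂ n, (⋃ k, B k) \ B n = ∅ := by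
    rw [← sdiff_iUnion, Set.sdiff_self]
  rwa [hempty, hφ.1.1] at h

/-- A countable union of null sets of a Maharam submeasure is null. -/
theorem Maharam.iUnion_null {φ : Set Cantor → ℝ≥0} (hφ : Maharam φ)
    {C : ℕ → Set Cantor} (hC : ∀ n, MeasurableSet (C n)) (h : ∀ n, φ (C n) = 0) :
    φ (⋃ n, C n) = 0 := by
  have hacc : ∀ n, MeasurableSet (accumulate C n) := fun n =>
    MeasurableSet.biUnion (to_countable _) fun k _ => hC k
  have hnull : ∀ n, φ (accumulate C n) = 0 := by
    intro n
    induction n with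
    | zero => simpa using h 0
    | succ n ih =>
      rw [accumulate_succ]
      exact le_antisymm ((hφ.1.apply_union_null (hacc n) (hC _) (h _)).trans ih.le) zero_le
  have ht := hφ.tendsto_iUnion_diff hacc monotone_accumulate
  rw [iUnion_accumulate] at ht
  refine le_antisymm (ge_of_tendsto' ht fun n => ?_) zero_le
  have hd := (MeasurableSet.iUnion hC).diff (hacc n)
  refine (hφ.1.2.1 _ _ (MeasurableSet.iUnion hC) (hd.union (hacc n)) ?_).trans
    (hφ.1.apply_union_null hd (hacc n) (hnull n))
  rw [sdiff_union_self]
  exact subset_union_left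

/-- The exhaustion principle: a class of Borel sets closed under countable unions has a largest
element modulo null sets of a Maharam submeasure. -/
theorem Maharam.exists_largest {φ : Set Cantor → ℝ≥0} (hφ : Maharam φ)
    {P : Set Cantor → Prop} (hmeas : ∀ A, P A → MeasurableSet A) (hempty : P ∅)
    (hunion : ∀ f : ℕ → Set Cantor, (∀ n, P (f n)) → P (⋃ n, f n)) :
    ∃ B, P B ∧ ∀ A, P A → φ (A \ B) = 0 := by
  have hunion₂ : ∀ A B, P A → P B → P (A ∪ B) := by
    intro A B hA hB
    have h := hunion (fun n => Nat.casesOn n A fun _ => B) (by rintro (_ | n) <;> assumption)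
    rw [← Set.union_iUnion_nat_succ] at h
    simpa [iUnion_const] using h
  have step : ∀ B, P B → ∃ C, P C ∧ ∀ A, P A → φ (A \ B) ≤ 2 * φ (C \ B) := by
    intro B hB
    by_cases hnull : ∀ A, P A → φ (A \ B) = 0
    · exact ⟨B, hB, fun A hA => by simp [hnull A hA]⟩
    · push Not at hnull
      obtain ⟨A₀, hA₀, hne⟩ := hnull
      let S : Set ℝ≥0 := {r | ∃ A, P A ∧ φ (A \ B) = r}
      have hbdd : BddAbove S := ⟨φ univ, by
        rintro _ ⟨A, hA, rfl⟩
        exact hφ.1.2.1 _ _ ((hmeas A hA).diff (hmeas B hB)) .univ (subset_univ _)⟩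
      have hpos : 0 < sSup S := (pos_iff_ne_zero.2 hne).trans_le (le_csSup hbdd ⟨A₀, hA₀, rfl⟩)
      obtain ⟨_, ⟨C, hC, rfl⟩, hlt⟩ := exists_lt_of_lt_csSup (s := S) ⟨_, A₀, hA₀, rfl⟩ (half_lt_self hpos)
      refine ⟨C, hC, fun A hA => (le_csSup hbdd ⟨A, hA, rfl⟩).trans ?_⟩
      rw [div_lt_iff₀ two_pos, mul_comm] at hlt
      exact hlt.le
  choose g hgP hg using step
  let F : ℕ → {B // P B} := fun n =>
    Nat.rec ⟨∅, hempty⟩ (fun _ B => ⟨B.1 ∪ g B.1 B.2, hunion₂ _ _ B.2 (hgP _ _)⟩) n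
  have hF : ∀ n, MeasurableSet (F n).1 := fun n => hmeas _ (F n).2
  have hmono : Monotone fun n => (F n).1 := monotone_nat_of_le_succ fun n => subset_union_left
  have hlim := (hφ.tendsto_iUnion_diff hF hmono).const_mul 2
  rw [mul_zero] at hlim
  refine ⟨⋃ n, (F n).1, hunion _ fun n => (F n).2, fun A hA => ?_⟩
  refine le_antisymm (ge_of_tendsto' hlim fun n => ?_) zero_le
  have hAm := hmeas A hA
  have hU := MeasurableSet.iUnion hF
  calc φ (A \ ⋃ n, (F n).1) ≤ φ (A \ (F n).1) :=
        hφ.1.2.1 _ _ (hAm.diff hU) (hAm.diff (hF n))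
          (sdiff_subset_sdiff_right (subset_iUnion (fun n => (F n).1) n))
    _ ≤ 2 * φ (g (F n).1 (F n).2 \ (F n).1) := hg _ _ A hA
    _ ≤ 2 * φ ((⋃ n, (F n).1) \ (F n).1) := by
        gcongr
        refine hφ.1.2.1 _ _ ((hmeas _ (hgP _ _)).diff (hF n)) (hU.diff (hF n))
          (sdiff_subset_sdiff_left ?_)
        exact subset_union_right.trans (subset_iUnion (fun n => (F n).1) (n + 1))

/-- `φ` has a control measure on `B`. -/
def HasControlMeasureOn (φ : Set Cantor → ℝ≥0) (B : Set Cantor) : Prop :=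
  ∃ μ : MeasureTheory.Measure Cantor, MeasureTheory.IsFiniteMeasure μ ∧
    ∀ C : Set Cantor, MeasurableSet C → C ⊆ B → (μ C = 0 ↔ φ C = 0)

theorem Maharam.hasControlMeasureOn_iUnion {φ : Set Cantor → ℝ≥0} (hφ : Maharam φ)
    {B : ℕ → Set Cantor} (hB : ∀ n, MeasurableSet (B n)) (h : ∀ n, HasControlMeasureOn φ (B n)) :
    HasControlMeasureOn φ (⋃ n, B n) := by
  choose μ hfin hμ using h
  have := hfin
  refine ⟨(MeasureTheory.Measure.sum fun n => (μ n).restrict (B n)).toFinite, inferInstance,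
    fun C hC hsub => ?_⟩
  have hCB : ⋃ n, C ∩ B n = C := by rw [← inter_iUnion, inter_eq_left.2 hsub]
  have key : ∀ n, μ n (C ∩ B n) = 0 ↔ φ (C ∩ B n) = 0 := fun n =>
    hμ n _ (hC.inter (hB n)) inter_subset_right
  rw [MeasureTheory.toFinite_apply_eq_zero_iff,
    MeasureTheory.Measure.sum_apply_eq_zero]
  simp only [MeasureTheory.Measure.restrict_apply hC, key]
  refine ⟨fun h0 => hCB ▸ hφ.iUnion_null (fun n => hC.inter (hB n)) h0, fun h0 n => ?_⟩
  exact le_antisymm ((hφ.1.2.1 _ _ (hC.inter (hB n)) hC inter_subset_left).trans h0.le) zero_le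

/-- If a finite measure is absolutely continuous with respect to a Maharam submeasure, then it is
a control measure outside one of its own null sets. -/
theorem Maharam.exists_hasControlMeasureOn_compl {φ : Set Cantor → ℝ≥0} (hφ : Maharam φ)
    (μ : MeasureTheory.Measure Cantor) [MeasureTheory.IsFiniteMeasure μ]
    (hac : ∀ A, MeasurableSet A → φ A = 0 → μ A = 0) :
    ∃ N, MeasurableSet N ∧ μ N = 0 ∧ HasControlMeasureOn φ Nᶜ := by
  obtain ⟨N, ⟨hN, hμN⟩, hmax⟩ := hφ.exists_largest (P := fun A => MeasurableSet A ∧ μ A = 0)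
    (fun A hA => hA.1) ⟨.empty, MeasureTheory.measure_empty⟩ fun f hf =>
      ⟨.iUnion fun n => (hf n).1, MeasureTheory.measure_iUnion_null fun n => (hf n).2⟩
  refine ⟨N, hN, hμN, μ, inferInstance, fun C hC hsub => ⟨fun h => ?_, hac C hC⟩⟩
  have hCN : C \ N = C := by rw [sdiff_eq, inter_eq_left.2 hsub]
  simpa only [hCN] using hmax C ⟨hC, h⟩

theorem FinAdd.biUnion_range {ν : Set Cantor → ℝ≥0} (hν : FinAdd ν) {f : ℕ → Set Cantor}
    (hf : ∀ n, MeasurableSet (f n)) (hdisj : Pairwise (Function.onFun Disjoint f)) (n : ℕ) :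
    ν (⋃ i ∈ Finset.range n, f i) = ∑ i ∈ Finset.range n, ν (f i) := by
  induction n with
  | zero => simpa using hν.1
  | succ n ih =>
    rw [Finset.sum_range_succ, ← ih, ← hν.2 _ _
      ((Finset.range n).measurableSet_biUnion fun i _ => hf i) (hf n), Finset.range_add_one,
      Finset.set_biUnion_insert, union_comm]
    simp only [disjoint_iUnion_left]
    exact fun i hi => hdisj (Finset.mem_range.1 hi).ne

/-- A finitely additive functional dominated by a Maharam submeasure is countably additive. -/
theorem FinAdd.hasSum_iUnion {φ ν : Set Cantor → ℝ≥0} (hφ : Maharam φ) (hν : FinAdd ν)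
    (hle : ∀ A, MeasurableSet A → ν A ≤ φ A) {f : ℕ → Set Cantor}
    (hf : ∀ n, MeasurableSet (f n)) (hdisj : Pairwise (Function.onFun Disjoint f)) :
    HasSum (fun n => ν (f n)) (ν (⋃ n, f n)) := by
  let G : ℕ → Set Cantor := fun n => ⋃ i ∈ Finset.range n, f i
  have hG : ∀ n, MeasurableSet (G n) := fun n =>
    (Finset.range n).measurableSet_biUnion fun i _ => hf i
  have hmono : Monotone G := fun m n hmn =>
    biUnion_subset_biUnion_left fun i hi => Finset.range_mono hmn hi
  have hGU : ⋃ n, G n = ⋃ n, f n := by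
    refine subset_antisymm (iUnion_subset fun n => iUnion₂_subset fun i _ => subset_iUnion f i)
      (iUnion_subset fun i => ?_)
    exact (subset_biUnion_of_mem (u := f) (Finset.self_mem_range_succ i)).trans
      (subset_iUnion G (i + 1))
  have hlim := hφ.tendsto_iUnion_diff hG hmono
  rw [hGU] at hlim
  have hU := MeasurableSet.iUnion hf
  have hrest : Tendsto (fun n => ν ((⋃ k, f k) \ G n)) atTop (nhds 0) :=
    tendsto_of_tendsto_of_tendsto_of_le_of_le tendsto_const_nhds hlim (fun _ => zero_le)
      fun n => hle _ (hU.diff (hG n))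
  have hsplit : ∀ n, ν (⋃ k, f k) - ν ((⋃ k, f k) \ G n) = ∑ i ∈ Finset.range n, ν (f i) := by
    intro n
    rw [← hν.biUnion_range hf hdisj n]
    have h := hν.2 (G n) _ (hG n) (hU.diff (hG n)) disjoint_sdiff_right
    rw [union_sdiff_cancel (hGU ▸ subset_iUnion G n)] at h
    rw [h, add_tsub_cancel_right]
  rw [NNReal.hasSum_iff_tendsto_nat]
  simpa [hsplit] using (tendsto_const_nhds (x := ν (⋃ k, f k))).sub hrest

/-- A finitely additive functional dominated by a Maharam submeasure extends to a measure. -/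
theorem FinAdd.exists_measure {φ ν : Set Cantor → ℝ≥0} (hφ : Maharam φ) (hν : FinAdd ν)
    (hle : ∀ A, MeasurableSet A → ν A ≤ φ A) :
    ∃ μ : MeasureTheory.Measure Cantor, ∀ A, MeasurableSet A → μ A = ν A :=
  ⟨.ofMeasurable (fun A _ => ν A) (by simp [hν.1]) fun _ hf hdisj =>
    (ENNReal.hasSum_coe.2 (hν.hasSum_iUnion hφ hle hf hdisj)).tsum_eq.symm,
    fun _ hA => MeasureTheory.Measure.ofMeasurable_apply _ hA⟩

/-- Decomposition of a Maharam submeasure: there is a Borel set `B` such that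
`φ` has a control measure on `B` and `φ` is pathological on the complement of
`B`. -/
theorem stmt6 (φ : Set Cantor → ℝ≥0) (hφ : Maharam φ) :
    ∃ B : Set Cantor, MeasurableSet B ∧
      (∃ μ : MeasureTheory.Measure Cantor, MeasureTheory.IsFiniteMeasure μ ∧
        ∀ C : Set Cantor, MeasurableSet C → C ⊆ B → (μ C = 0 ↔ φ C = 0)) ∧
      ¬ ∃ ν : Set Cantor → ℝ≥0, FinAdd ν ∧
          (∀ A : Set Cantor, MeasurableSet A → ν A ≤ φ (A \ B)) ∧ 0 < ν univ := by
  obtain ⟨B, ⟨hB, hBc⟩, hmax⟩ := hφ.exists_largest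
    (P := fun A => MeasurableSet A ∧ HasControlMeasureOn φ A) (fun A hA => hA.1)
    ⟨.empty, 0, inferInstance, fun C _ hsub => by simp [subset_empty_iff.1 hsub, hφ.1.1]⟩
    fun f hf => ⟨.iUnion fun n => (hf n).1,
      hφ.hasControlMeasureOn_iUnion (fun n => (hf n).1) fun n => (hf n).2⟩
  refine ⟨B, hB, hBc, ?_⟩
  rintro ⟨ν, hν, hle, hpos⟩
  have hle' : ∀ A, MeasurableSet A → ν A ≤ φ A := fun A hA =>
    (hle A hA).trans (hφ.1.2.1 _ _ (hA.diff hB) hA sdiff_subset)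
  obtain ⟨μ, hμ⟩ := hν.exists_measure hφ hle'
  have : MeasureTheory.IsFiniteMeasure μ := ⟨by simp [hμ univ .univ]⟩
  obtain ⟨N, hN, hμN, hNc⟩ := hφ.exists_hasControlMeasureOn_compl μ fun A hA h => by
    simpa [hμ A hA, h] using hle' A hA
  have hνN : ν N = 0 := by simpa [hμ N hN] using hμN
  have hνNc : ν Nᶜ = 0 := by simpa [hmax Nᶜ ⟨hN.compl, hNc⟩] using hle Nᶜ hN.compl
  have hsum := hν.2 N Nᶜ hN hN.compl disjoint_compl_right
  rw [union_compl_self, hνN, hνNc, add_zero] at hsum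
  exact hpos.ne' hsum
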